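/- Let u : ℝ × (0,∞) → ℝ be smooth and satisfy the one-dimensional heat equation ∂u/∂t (ρ,t) = ∂²u/∂ρ² (ρ,t). Define v(ρ,t) = −e^{−t} · (∂u/∂ρ)(ρ,t) / sinh(ρ). Then for all ρ > 0 and t > 0, v satisfies ∂v/∂t = ∂²v/∂ρ² + 2·(cosh ρ / sinh ρ)·∂v/∂ρ. -/

import Mathlib

/-- The open upper half plane `t > 0`. -/
def hypU : Set (ℝ × ℝ) := Set.univ ×ˢ Set.Ioi (0 : ℝ)

lemma hypU_open : IsOpen hypU := isOpen_univ.prod isOpen_Ioi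

lemma mem_hypU {x t : ℝ} (ht : 0 < t) : (x, t) ∈ hypU := ⟨Set.mem_univ _, ht⟩

lemma hyp_diffAt {G : ℝ × ℝ → ℝ} (hG : ContDiffOn ℝ (⊤ : ℕ∞) G hypU) {p : ℝ × ℝ}
    (hp : p ∈ hypU) : DifferentiableAt ℝ G p :=
  (hG.contDiffAt (hypU_open.mem_nhds hp)).differentiableAt (by simp)

lemma hyp_slice1 {G : ℝ × ℝ → ℝ} (hG : ContDiffOn ℝ (⊤ : ℕ∞) G hypU) (x : ℝ) {t : ℝ}
    (ht : 0 < t) : HasDerivAt (fun y => G (y, t)) (fderiv ℝ G (x, t) (1, 0)) x := by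
  have h1 : HasDerivAt (fun y : ℝ => (y, t)) ((1 : ℝ), (0 : ℝ)) x :=
    (hasDerivAt_id x).prodMk (hasDerivAt_const x t)
  exact (hyp_diffAt hG (mem_hypU ht)).hasFDerivAt.comp_hasDerivAt x h1

lemma hyp_slice2 {G : ℝ × ℝ → ℝ} (hG : ContDiffOn ℝ (⊤ : ℕ∞) G hypU) (x : ℝ) {t : ℝ}
    (ht : 0 < t) : HasDerivAt (fun s => G (x, s)) (fderiv ℝ G (x, t) (0, 1)) t := by
  have h1 : HasDerivAt (fun s : ℝ => (x, s)) ((0 : ℝ), (1 : ℝ)) t :=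
    (hasDerivAt_const t x).prodMk (hasDerivAt_id t)
  exact (hyp_diffAt hG (mem_hypU ht)).hasFDerivAt.comp_hasDerivAt t h1

lemma hyp_smooth_fderiv {G : ℝ × ℝ → ℝ} (hG : ContDiffOn ℝ (⊤ : ℕ∞) G hypU) :
    ContDiffOn ℝ (⊤ : ℕ∞) (fderiv ℝ G) hypU :=
  hG.fderiv_of_isOpen hypU_open (by simp)

lemma hyp_smooth {G : ℝ × ℝ → ℝ} (hG : ContDiffOn ℝ (⊤ : ℕ∞) G hypU) (e : ℝ × ℝ) :
    ContDiffOn ℝ (⊤ : ℕ∞) (fun p => fderiv ℝ G p e) hypU :=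
  (hyp_smooth_fderiv hG).clm_apply contDiffOn_const

lemma hyp_symm {G : ℝ × ℝ → ℝ} (hG : ContDiffOn ℝ (⊤ : ℕ∞) G hypU) {p : ℝ × ℝ}
    (hp : p ∈ hypU) (e f : ℝ × ℝ) :
    fderiv ℝ (fun q => fderiv ℝ G q e) p f = fderiv ℝ (fun q => fderiv ℝ G q f) p e := by
  have hd : DifferentiableAt ℝ (fderiv ℝ G) p :=
    ((hyp_smooth_fderiv hG).contDiffAt (hypU_open.mem_nhds hp)).differentiableAt (by simp)
  have hs : IsSymmSndFDerivAt ℝ G p :=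
    (hG.contDiffAt (hypU_open.mem_nhds hp)).isSymmSndFDerivAt (by
      simp only [minSmoothness_of_isRCLikeNormedField]
      exact WithTop.coe_le_coe.2 (le_top : (2 : ℕ∞) ≤ ⊤))
  have key : ∀ a b : ℝ × ℝ, fderiv ℝ (fun q => fderiv ℝ G q a) p b
      = fderiv ℝ (fderiv ℝ G) p b a := by
    intro a b
    rw [fderiv_clm_apply hd (differentiableAt_const a)]
    simp
  rw [key, key]
  exact hs f e


/-- The `H³` intertwining relation: if `u` is a smooth solution of the one-dimensional
heat equation on `ℝ × (0,∞)`, then `v(ρ,t) = -e^{-t} ∂_ρ u(ρ,t) / sinh ρ` satisfies the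
radial heat equation on 3-dimensional hyperbolic space,
`∂v/∂t = ∂²v/∂ρ² + 2 coth(ρ) ∂v/∂ρ`, for `ρ > 0` and `t > 0`. -/
theorem hyperbolic3_intertwining_relation
    (u : ℝ → ℝ → ℝ)
    (hu : ContDiffOn ℝ (⊤ : ℕ∞) (fun p : ℝ × ℝ => u p.1 p.2) (Set.univ ×ˢ Set.Ioi (0 : ℝ)))
    (hheat : ∀ ρ : ℝ, ∀ t : ℝ, 0 < t →
      deriv (fun s => u ρ s) t = deriv (fun x => deriv (fun y => u y t) x) ρ)
    (v : ℝ → ℝ → ℝ)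
    (hv : ∀ ρ t : ℝ, v ρ t = -Real.exp (-t) * deriv (fun x => u x t) ρ / Real.sinh ρ) :
    ∀ ρ : ℝ, 0 < ρ → ∀ t : ℝ, 0 < t →
      deriv (fun s => v ρ s) t
        = deriv (fun x => deriv (fun y => v y t) x) ρ
          + 2 * (Real.cosh ρ / Real.sinh ρ) * deriv (fun x => v x t) ρ := by
  intro ρ hρ t ht
  set F : ℝ × ℝ → ℝ := fun p => u p.1 p.2 with hF
  have h0 : ContDiffOn ℝ (⊤ : ℕ∞) F hypU := hu
  set A : ℝ × ℝ → ℝ := fun p => fderiv ℝ F p (1, 0) with hA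
  have h1 : ContDiffOn ℝ (⊤ : ℕ∞) A hypU := hyp_smooth h0 _
  set B : ℝ × ℝ → ℝ := fun p => fderiv ℝ A p (1, 0) with hB
  have h2 : ContDiffOn ℝ (⊤ : ℕ∞) B hypU := hyp_smooth h1 _
  have eA : ∀ x s : ℝ, 0 < s → deriv (fun y => u y s) x = A (x, s) :=
    fun x s hs => (hyp_slice1 h0 x hs).deriv
  have heat : ∀ p ∈ hypU, fderiv ℝ F p (0, 1) = B p := by
    rintro ⟨x, s⟩ ⟨-, hs⟩
    have hs' : 0 < s := hs
    have e1 : deriv (fun r => u x r) s = fderiv ℝ F (x, s) (0, 1) := (hyp_slice2 h0 x hs').deriv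
    have e2 : deriv (fun y => A (y, s)) x = B (x, s) := (hyp_slice1 h1 x hs').deriv
    rw [← e1, hheat x s hs', ← e2]
    congr 1
    funext y
    exact eA y s hs'
  have hAt : fderiv ℝ A (ρ, t) (0, 1) = fderiv ℝ B (ρ, t) (1, 0) := by
    rw [hA, hyp_symm h0 (mem_hypU ht)]
    have : (fun q => fderiv ℝ F q (0, 1)) =ᶠ[nhds (ρ, t)] B :=
      Filter.eventually_of_mem (hypU_open.mem_nhds (mem_hypU ht)) heat
    rw [this.fderiv_eq]
  have hs : ∀ x : ℝ, 0 < x → Real.sinh x ≠ 0 := fun x hx => (Real.sinh_pos_iff.2 hx).ne'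
  have dt : HasDerivAt (fun s => v ρ s)
      ((Real.exp (-t) * A (ρ, t) - Real.exp (-t) * fderiv ℝ B (ρ, t) (1, 0)) / Real.sinh ρ) t := by
    have hA2 := hyp_slice2 h1 ρ ht
    rw [hAt] at hA2
    have he : HasDerivAt (fun s : ℝ => -Real.exp (-s)) (Real.exp (-t)) t := by
      have := ((hasDerivAt_id t).neg.exp).neg
      exact this.congr_deriv (by simp)
    have := (he.mul hA2).div_const (Real.sinh ρ)
    refine (this.congr_of_eventuallyEq ?_).congr_deriv (by ring)
    filter_upwards [Ioi_mem_nhds ht] with s hs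
    rw [hv, eA _ _ hs]
    rfl
  have hvx : (fun y => v y t) = fun y => -Real.exp (-t) * A (y, t) / Real.sinh y := by
    funext y
    rw [hv, eA _ _ ht]
  have dx : ∀ x : ℝ, 0 < x → HasDerivAt (fun y => v y t)
      (((-Real.exp (-t) * B (x, t)) * Real.sinh x - (-Real.exp (-t) * A (x, t)) * Real.cosh x)
        / Real.sinh x ^ 2) x := by
    intro x hx
    rw [hvx]
    exact ((hyp_slice1 h1 x ht).const_mul _).div (Real.hasDerivAt_sinh x) (hs x hx)
  have hA1 := (hyp_slice1 h1 ρ ht).const_mul (-Real.exp (-t))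
  have hB1 := (hyp_slice1 h2 ρ ht).const_mul (-Real.exp (-t))
  have dxx := ((hB1.mul (Real.hasDerivAt_sinh ρ)).sub (hA1.mul (Real.hasDerivAt_cosh ρ))).div
    ((Real.hasDerivAt_sinh ρ).pow 2) (pow_ne_zero 2 (hs ρ hρ))
  have dxx' := dxx.congr_of_eventuallyEq (f₁ := fun x => deriv (fun y => v y t) x) (by
    filter_upwards [Ioi_mem_nhds hρ] with x hx
    rw [(dx x hx).deriv]
    rfl)
  rw [dt.deriv, dxx'.deriv, (dx ρ hρ).deriv]
  change _ = _
  have hc : Real.cosh ρ ^ 2 = Real.sinh ρ ^ 2 + 1 := Real.cosh_sq ρ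
  have hsρ := hs ρ hρ
  have hBB : fderiv ℝ A (ρ, t) (1, 0) = B (ρ, t) := rfl
  simp only [hBB, Pi.mul_apply, Pi.sub_apply, Pi.pow_apply]
  generalize fderiv ℝ B (ρ, t) (1, 0) = C
  generalize A (ρ, t) = a
  generalize B (ρ, t) = b
  generalize Real.exp (-t) = E
  generalize Real.sinh ρ = S at *
  generalize Real.cosh ρ = K at *
  field_simp
  push_cast
  ring_nf
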